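/- arXiv:1608.04707 — 2 statements merged into one kernel-verified Lean document; each statement's English description precedes it below -/
import Mathlib

section
/- Let Ψ : ℝ³ → ℍ be continuously differentiable. Then for every x ∈ ℝ³ with x ≠ 0 and every i ∈ {1,2,3}: (∇ᵢ(ĵ(·)·Ψ))(x) = ĵ(x)·(∇ᵢΨ)(x), where ĵ(·)·Ψ denotes the function y ↦ ĵ(y)·Ψ(y) on ℝ³∖{0}. That is, the operator J of left multiplication by ĵ(x) commutes with each covariant derivative ∇ᵢ. -/
noncomputable section
open scoped Quaternion
open MeasureTheory

abbrev R3 : Type := EuclideanSpace ℝ (Fin 3)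

/-- Levi-Civita symbol on `Fin 3`. -/
def eps (i j k : Fin 3) : ℝ :=
  (((j : ℕ) : ℝ) - ((i : ℕ) : ℝ)) * (((k : ℕ) : ℝ) - ((i : ℕ) : ℝ)) *
    (((k : ℕ) : ℝ) - ((j : ℕ) : ℝ)) / 2

/-- The quaternionic imaginary units 𝔢₁, 𝔢₂, 𝔢₃. -/
def qe : Fin 3 → ℍ[ℝ] := ![⟨0,1,0,0⟩, ⟨0,0,1,0⟩, ⟨0,0,0,1⟩]

/-- ĵ(z) = (Σₖ zᵏ 𝔢ₖ)/|z|. -/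
def jhat (z : R3) : ℍ[ℝ] := ‖z‖⁻¹ • ∑ k, z k • qe k

/-- Partial derivative ∂ᵢ of a quaternion-valued function. -/
def pderiv (i : Fin 3) (Ψ : R3 → ℍ[ℝ]) (x : R3) : ℍ[ℝ] :=
  fderiv ℝ Ψ x (EuclideanSpace.single i 1)

/-- Covariant derivative ∇ᵢ. -/
def cov (i : Fin 3) (Ψ : R3 → ℍ[ℝ]) (x : R3) : ℍ[ℝ] :=
  pderiv i Ψ x + (1/2 : ℝ) • ∑ j, ∑ k, (eps i j k * x j / ‖x‖^2) • (qe k * Ψ x)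

theorem hasFDerivAt_norm_inv {x : R3} (hx : x ≠ 0) :
    HasFDerivAt (fun y : R3 => ‖y‖⁻¹) (-(‖x‖ ^ 3)⁻¹ • innerSL ℝ x) x := by
  have hn : ‖x‖ ≠ 0 := norm_ne_zero_iff.mpr hx
  have h := (((hasStrictFDerivAt_norm_sq x).hasFDerivAt).sqrt (pow_ne_zero 2 hn))
  simp only [Real.sqrt_sq (norm_nonneg _)] at h
  refine ((hasDerivAt_inv hn).comp_hasFDerivAt x h).congr_fderiv ?_
  ext v
  simp
  field_simp

theorem hasFDerivAt_sum_smul_qe (x : R3) :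
    HasFDerivAt (fun y : R3 => ∑ k, y k • qe k)
      (∑ k, (EuclideanSpace.proj k : R3 →L[ℝ] ℝ).smulRight (qe k)) x :=
  HasFDerivAt.fun_sum fun k _ =>
    ((EuclideanSpace.proj k : R3 →L[ℝ] ℝ).hasFDerivAt).smul_const (qe k)

theorem differentiableAt_jhat {x : R3} (hx : x ≠ 0) : DifferentiableAt ℝ jhat x :=
  ((hasFDerivAt_norm_inv hx).smul (hasFDerivAt_sum_smul_qe x)).differentiableAt

theorem pderiv_jhat {x : R3} (hx : x ≠ 0) (i : Fin 3) :
    pderiv i jhat x = ‖x‖⁻¹ • qe i - (x i / ‖x‖ ^ 3) • ∑ k, x k • qe k := by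
  have h : HasFDerivAt jhat _ x := (hasFDerivAt_norm_inv hx).smul (hasFDerivAt_sum_smul_qe x)
  rw [pderiv, h.fderiv]
  simp [PiLp.single_apply, div_eq_inv_mul, sub_eq_add_neg, EuclideanSpace.inner_single_right]

/-- The connection form `Aᵢ`, so that `∇ᵢ = ∂ᵢ + Aᵢ`. -/
def connectionForm (i : Fin 3) (x : R3) : ℍ[ℝ] :=
  (1 / 2 : ℝ) • ∑ j, ∑ k, (eps i j k * x j / ‖x‖ ^ 2) • qe k

theorem cov_eq (i : Fin 3) (Ψ : R3 → ℍ[ℝ]) (x : R3) :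
    cov i Ψ x = pderiv i Ψ x + connectionForm i x * Ψ x := by
  simp only [cov, connectionForm, smul_mul_assoc, Finset.sum_mul]

theorem pderiv_mul {f g : R3 → ℍ[ℝ]} {x : R3} (hf : DifferentiableAt ℝ f x)
    (hg : DifferentiableAt ℝ g x) (i : Fin 3) :
    pderiv i (fun y => f y * g y) x = f x * pderiv i g x + pderiv i f x * g x := by
  simp [pderiv, fderiv_fun_mul' hf hg]

theorem qe_re (k : Fin 3) : (qe k).re = 0 := by fin_cases k <;> rfl

theorem qe_imI (k : Fin 3) : (qe k).imI = if k = 0 then 1 else 0 := by fin_cases k <;> rfl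

theorem qe_imJ (k : Fin 3) : (qe k).imJ = if k = 1 then 1 else 0 := by fin_cases k <;> rfl

theorem qe_imK (k : Fin 3) : (qe k).imK = if k = 2 then 1 else 0 := by fin_cases k <;> rfl

set_option maxHeartbeats 1600000 in
/-- The section `ĵ` is parallel for the connection induced on endomorphisms. -/
theorem pderiv_jhat_add_connectionForm_mul {x : R3} (hx : x ≠ 0) (i : Fin 3) :
    pderiv i jhat x + connectionForm i x * jhat x = jhat x * connectionForm i x := by
  have hs : ‖x‖⁻¹ ^ 2 * (x 0 ^ 2 + x 1 ^ 2 + x 2 ^ 2) = 1 := by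
    rw [← Fin.sum_univ_three fun k => x k ^ 2, ← EuclideanSpace.real_norm_sq_eq, ← mul_pow,
      inv_mul_cancel₀ (norm_ne_zero_iff.mpr hx), one_pow]
  rw [pderiv_jhat hx]
  unfold connectionForm jhat
  simp only [div_eq_mul_inv _ (‖x‖ ^ _), ← inv_pow]
  generalize ‖x‖⁻¹ = s at hs ⊢
  fin_cases i <;> ext <;> simp [eps, qe_re, qe_imI, qe_imJ, qe_imK, Fin.sum_univ_three] <;>
    first | ring1 | linear_combination (-s) * hs

/-- left multiplication by `ĵ(x)` commutes with each covariant derivative `∇ᵢ`. -/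
theorem stmt1 (Ψ : R3 → ℍ[ℝ]) (hΨ : ContDiff ℝ 1 Ψ) (x : R3) (hx : x ≠ 0) (i : Fin 3) :
    cov i (fun y => jhat y * Ψ y) x = jhat x * cov i Ψ x := by
  have hg : DifferentiableAt ℝ Ψ x := (hΨ.differentiable one_ne_zero).differentiableAt
  rw [cov_eq, cov_eq, pderiv_mul (differentiableAt_jhat hx) hg, mul_add, ← mul_assoc,
    ← mul_assoc, ← pderiv_jhat_add_connectionForm_mul hx, add_mul, add_assoc]
end
end

section
/- Let κ ∈ ℝ and β_{ij}(q) = κ Σₖ ε_{ijk} qᵏ/|q|³ on ℝ³∖{0}, and define the magnetic Poisson bracket of smooth functions f, g on the phase space ℝ³×(ℝ³∖{0}) with coordinates (p,q) by {f,g}_B = Σᵢ( ∂f/∂qⁱ ∂g/∂pᵢ − ∂f/∂pᵢ ∂g/∂qⁱ ) + Σ_{i,j} β_{ij}(q) ∂f/∂pᵢ ∂g/∂pⱼ. Then {·,·}_B satisfies the Jacobi identity: for all smooth f, g, h : ℝ³×(ℝ³∖{0}) → ℝ and at every point of ℝ³×(ℝ³∖{0}), {{f,g}_B, h}_B + {{g,h}_B,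 f}_B + {{h,f}_B, g}_B = 0. -/
noncomputable section

/-- The phase space `ℝ³ × ℝ³` with coordinates `(p, q)`;
the physical phase space is the open subset `{z | z.2 ≠ 0}`. -/
abbrev Phase : Type := R3 × R3

/-- Partial derivative `∂_{pᵢ}`. -/
def dp {E : Type} [NormedAddCommGroup E] [NormedSpace ℝ E]
    (i : Fin 3) (f : Phase → E) (z : Phase) : E :=
  fderiv ℝ f z (EuclideanSpace.single i 1, 0)

/-- Partial derivative `∂_{qⁱ}`. -/
def dq {E : Type} [NormedAddCommGroup E] [NormedSpace ℝ E]
    (i : Fin 3) (f : Phase → E) (z : Phase) : E :=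
  fderiv ℝ f z (0, EuclideanSpace.single i 1)

/-- The magnetic matrix `β_{ij}(q) = κ Σₖ ε_{ijk} qᵏ/|q|³`. -/
def beta (κ : ℝ) (i j : Fin 3) (q : R3) : ℝ := κ * ∑ k, eps i j k * q k / ‖q‖^3

/-- The magnetic Poisson bracket `{f,g}_B`. -/
def mbracket (κ : ℝ) (f g : Phase → ℝ) (z : Phase) : ℝ :=
  (∑ i, (dq i f z * dp i g z - dp i f z * dq i g z)) +
    ∑ i, ∑ j, beta κ i j z.2 * dp i f z * dp j g z

/-- The vector `Y` with `{f, g}_B = df(Y)` for `α = dg`. -/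
def hamVec (κ : ℝ) (q : R3) (α : Phase →L[ℝ] ℝ) : Phase :=
  (∑ i, (α (EuclideanSpace.single i 1, 0) • ((0, EuclideanSpace.single i 1) : Phase)
      - α (0, EuclideanSpace.single i 1) • ((EuclideanSpace.single i 1, 0) : Phase))) +
    ∑ i, ∑ j, (beta κ i j q * α (EuclideanSpace.single j 1, 0)) •
      ((EuclideanSpace.single i 1, 0) : Phase)

theorem apply_hamVec (κ : ℝ) (q : R3) (α γ : Phase →L[ℝ] ℝ) :
    γ (hamVec κ q α) =
      (∑ i, (γ (0, EuclideanSpace.single i 1) * α (EuclideanSpace.single i 1, 0)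
        - γ (EuclideanSpace.single i 1, 0) * α (0, EuclideanSpace.single i 1))) +
      ∑ i, ∑ j, beta κ i j q * γ (EuclideanSpace.single i 1, 0) *
        α (EuclideanSpace.single j 1, 0) := by
  simp only [hamVec, map_add, map_sum, map_sub, map_smul, smul_eq_mul]
  congr 1
  · exact Finset.sum_congr rfl fun i _ => by ring
  · exact Finset.sum_congr rfl fun i _ => Finset.sum_congr rfl fun j _ => by ring

theorem mbracket_eq_apply_hamVec (κ : ℝ) (f g : Phase → ℝ) (z : Phase) :
    mbracket κ f g z = fderiv ℝ f z (hamVec κ z.2 (fderiv ℝ g z)) :=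
  (apply_hamVec κ z.2 _ _).symm

theorem eps_swap (i j k : Fin 3) : eps j i k = -eps i j k := by
  simp only [eps]; ring

theorem beta_swap (κ : ℝ) (i j : Fin 3) (q : R3) : beta κ j i q = -beta κ i j q := by
  simp only [beta, eps_swap i j, neg_mul, neg_div, Finset.sum_neg_distrib, mul_neg]

theorem apply_hamVec_swap (κ : ℝ) (q : R3) (α γ : Phase →L[ℝ] ℝ) :
    γ (hamVec κ q α) = -α (hamVec κ q γ) := by
  rw [apply_hamVec, apply_hamVec, neg_add, ← Finset.sum_neg_distrib, ← Finset.sum_neg_distrib,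
    Finset.sum_comm (f := fun i j => beta κ i j q * _ * _)]
  congr 1
  · exact Finset.sum_congr rfl fun i _ => by ring
  · refine Finset.sum_congr rfl fun i _ => ?_
    rw [← Finset.sum_neg_distrib]
    exact Finset.sum_congr rfl fun j _ => by rw [beta_swap κ i j]; ring

theorem hamVec_snd_apply (κ : ℝ) (q : R3) (α : Phase →L[ℝ] ℝ) (k : Fin 3) :
    (hamVec κ q α).2 k = α (EuclideanSpace.single k 1, 0) := by
  simp [hamVec, Prod.snd_sum, Finset.sum_apply, Pi.single_apply]

theorem hasFDerivAt_beta (κ : ℝ) (i j : Fin 3) {q : R3} (hq : q ≠ 0) :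
    ∃ L : R3 →L[ℝ] ℝ, HasFDerivAt (beta κ i j) L q ∧ ∀ w, L w =
      κ * ∑ k, eps i j k * (w k / ‖q‖ ^ 3 - 3 * q k * (∑ l, q l * w l) / ‖q‖ ^ 5) := by
  have hr : ‖q‖ ≠ 0 := norm_ne_zero_iff.mpr hq
  have hd : DifferentiableAt ℝ (beta κ i j) q := by
    have hn : DifferentiableAt ℝ (fun x : R3 => ‖x‖) q := differentiableAt_id.norm ℝ hq
    unfold beta
    fun_prop (disch := exact pow_ne_zero 3 hr)
  refine ⟨_, hd.hasFDerivAt, fun w => ?_⟩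
  have hline : HasDerivAt (fun t : ℝ => q + t • w) w 0 := by
    simpa using ((hasDerivAt_id (0 : ℝ)).smul_const w).const_add q
  have hcomp : HasDerivAt (fun t : ℝ => beta κ i j (q + t • w)) (fderiv ℝ (beta κ i j) q w) 0 := by
    have := HasFDerivAt.comp_hasDerivAt (x := (0 : ℝ)) (f := fun t : ℝ => q + t • w)
      (l := beta κ i j) (l' := fderiv ℝ (beta κ i j) q) (f' := w)
      (by simpa using hd.hasFDerivAt) hline
    exact this
  have hsq : HasDerivAt (fun t : ℝ => ‖q + t • w‖ ^ 2) (2 * ∑ l, q l * w l) 0 := by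
    have := hline.norm_sq
    simpa [PiLp.inner_apply, mul_comm] using this
  have hnorm : HasDerivAt (fun t : ℝ => ‖q + t • w‖) ((∑ l, q l * w l) / ‖q‖) 0 := by
    have := hsq.sqrt (by simpa using hr)
    simp only [Real.sqrt_sq (norm_nonneg _)] at this
    convert this using 1
    simp only [zero_smul, add_zero]
    field_simp
  have hk : ∀ k, HasDerivAt (fun t : ℝ => eps i j k * (q + t • w) k / ‖q + t • w‖ ^ 3)
      (eps i j k * (w k / ‖q‖ ^ 3 - 3 * q k * (∑ l, q l * w l) / ‖q‖ ^ 5)) 0 := by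
    intro k
    have h1 : HasDerivAt (fun t : ℝ => (q + t • w) k) (w k) 0 := by
      simpa using ((hasDerivAt_id (0 : ℝ)).mul_const (w k)).const_add (q k)
    refine ((h1.const_mul (eps i j k)).fun_div (hnorm.fun_pow 3)
      (by simpa using hr)).congr_deriv ?_
    simp only [zero_smul, add_zero]
    field_simp
    ring
  exact hcomp.unique ((HasDerivAt.fun_sum fun k _ => hk k).const_mul κ)

theorem fderiv_mbracket_apply (κ : ℝ) {f g : Phase → ℝ} {z : Phase} (hz : z.2 ≠ 0)
    (hf : DifferentiableAt ℝ (fderiv ℝ f) z) (hg : DifferentiableAt ℝ (fderiv ℝ g) z)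
    (v : Phase) :
    fderiv ℝ (mbracket κ f g) z v =
      fderiv ℝ (fderiv ℝ f) z v (hamVec κ z.2 (fderiv ℝ g z)) +
      fderiv ℝ f z (hamVec κ z.2 (fderiv ℝ (fderiv ℝ g) z v)) +
      ∑ i, ∑ j, fderiv ℝ (beta κ i j) z.2 v.2 * dp i f z * dp j g z := by
  have hev : ∀ {u : Phase → ℝ}, DifferentiableAt ℝ (fderiv ℝ u) z → ∀ e : Phase,
      HasFDerivAt (fun x => fderiv ℝ u x e) ((fderiv ℝ (fderiv ℝ u) z).flip e) z := by
    intro u hu e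
    simpa using hu.hasFDerivAt.clm_apply (hasFDerivAt_const e z)
  have hb : ∀ i j, HasFDerivAt (fun x : Phase => beta κ i j x.2)
      ((fderiv ℝ (beta κ i j) z.2).comp (ContinuousLinearMap.snd ℝ R3 R3)) z := by
    intro i j
    obtain ⟨L, hL, -⟩ := hasFDerivAt_beta κ i j hz
    exact hL.differentiableAt.hasFDerivAt.comp z hasFDerivAt_snd
  have key : HasFDerivAt (mbracket κ f g) _ z :=
    (HasFDerivAt.fun_sum fun i (_ : i ∈ Finset.univ) =>
      ((hev hf (0, EuclideanSpace.single i 1)).fun_mul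
        (hev hg (EuclideanSpace.single i 1, 0))).fun_sub
      ((hev hf (EuclideanSpace.single i 1, 0)).fun_mul
        (hev hg (0, EuclideanSpace.single i 1)))).fun_add
    (HasFDerivAt.fun_sum fun i (_ : i ∈ Finset.univ) =>
      HasFDerivAt.fun_sum fun j (_ : j ∈ Finset.univ) =>
        ((hb i j).fun_mul (hev hf (EuclideanSpace.single i 1, 0))).fun_mul
          (hev hg (EuclideanSpace.single j 1, 0)))
  rw [key.fderiv, apply_hamVec, apply_hamVec]
  simp only [add_apply, sub_apply, smul_apply, smul_eq_mul,
    ContinuousLinearMap.flip_apply, ContinuousLinearMap.comp_apply,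
    ContinuousLinearMap.coe_snd', dp, Fin.sum_univ_three]
  ring

/-- The monopole field is divergence free, in the form `dβ = 0`. -/
theorem cyclic_sum_fderiv_beta (κ : ℝ) {q : R3} (hq : q ≠ 0) (a b c : R3) :
    (∑ i, ∑ j, fderiv ℝ (beta κ i j) q c * a i * b j) +
    (∑ i, ∑ j, fderiv ℝ (beta κ i j) q a * b i * c j) +
    (∑ i, ∑ j, fderiv ℝ (beta κ i j) q b * c i * a j) = 0 := by
  have hr : ‖q‖ ≠ 0 := norm_ne_zero_iff.mpr hq
  have hD : ∀ i j w, fderiv ℝ (beta κ i j) q w =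
      κ * ∑ k, eps i j k * (w k / ‖q‖ ^ 3 - 3 * q k * (∑ l, q l * w l) / ‖q‖ ^ 5) := by
    intro i j w
    obtain ⟨L, hL, h⟩ := hasFDerivAt_beta κ i j hq
    rw [hL.fderiv, h]
  have h2 : ‖q‖ ^ 2 = q 0 ^ 2 + q 1 ^ 2 + q 2 ^ 2 := by
    simp [EuclideanSpace.norm_sq_eq, Fin.sum_univ_three]
  have h3 : (‖q‖ ^ 3)⁻¹ = (q 0 ^ 2 + q 1 ^ 2 + q 2 ^ 2) * (‖q‖ ^ 5)⁻¹ := by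
    rw [← h2]; field_simp
  simp only [hD, div_eq_mul_inv, h3, eps,
    Fin.sum_univ_three, Fin.val_zero, Fin.val_one, Fin.val_two, Nat.cast_zero, Nat.cast_one,
    Nat.cast_ofNat]
  ring

/-- the magnetic Poisson bracket for the monopole field satisfies
the Jacobi identity on `ℝ³ × (ℝ³∖{0})`. -/
theorem stmt17 (κ : ℝ) (f g h : Phase → ℝ)
    (hf : ContDiffOn ℝ (⊤ : ℕ∞) f {z : Phase | z.2 ≠ 0})
    (hg : ContDiffOn ℝ (⊤ : ℕ∞) g {z : Phase | z.2 ≠ 0})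
    (hh : ContDiffOn ℝ (⊤ : ℕ∞) h {z : Phase | z.2 ≠ 0})
    (z : Phase) (hz : z.2 ≠ 0) :
    mbracket κ (mbracket κ f g) h z + mbracket κ (mbracket κ g h) f z
      + mbracket κ (mbracket κ h f) g z = 0 := by
  have hopen : IsOpen {z : Phase | z.2 ≠ 0} := isOpen_ne.preimage continuous_snd
  have hsmooth : ∀ {u : Phase → ℝ}, ContDiffOn ℝ (⊤ : ℕ∞) u {z : Phase | z.2 ≠ 0} →
      DifferentiableAt ℝ (fderiv ℝ u) z ∧ IsSymmSndFDerivAt ℝ u z := by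
    intro u hu
    have hc : ContDiffAt ℝ 2 u z :=
      (hu.contDiffAt (hopen.mem_nhds hz)).of_le (WithTop.coe_le_coe.2 (le_top : (2 : ℕ∞) ≤ ⊤))
    exact ⟨(hc.fderiv_right (m := 1) (by norm_num)).differentiableAt (by norm_num),
      hc.isSymmSndFDerivAt (by simp)⟩
  obtain ⟨df, sf⟩ := hsmooth hf
  obtain ⟨dg, sg⟩ := hsmooth hg
  obtain ⟨dh, sh⟩ := hsmooth hh
  have hβ := cyclic_sum_fderiv_beta κ hz (hamVec κ z.2 (fderiv ℝ f z)).2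
    (hamVec κ z.2 (fderiv ℝ g z)).2 (hamVec κ z.2 (fderiv ℝ h z)).2
  simp only [hamVec_snd_apply] at hβ
  rw [mbracket_eq_apply_hamVec κ (mbracket κ f g), mbracket_eq_apply_hamVec κ (mbracket κ g h),
    mbracket_eq_apply_hamVec κ (mbracket κ h f), fderiv_mbracket_apply κ hz df dg,
    fderiv_mbracket_apply κ hz dg dh, fderiv_mbracket_apply κ hz dh df,
    apply_hamVec_swap κ z.2 _ (fderiv ℝ f z), apply_hamVec_swap κ z.2 _ (fderiv ℝ g z),
    apply_hamVec_swap κ z.2 _ (fderiv ℝ h z), sf.eq (hamVec κ z.2 (fderiv ℝ h z)),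
    sg.eq (hamVec κ z.2 (fderiv ℝ h z)), sh.eq (hamVec κ z.2 (fderiv ℝ f z))]
  simp only [dp]
  linear_combination hβ
end
end
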